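/- Let d ≥ 1, L ≥ 3, and let Λ ⊂ ℤ^d be a finite cube centered at the origin with |Λ| ≤ L^d and |x₁| ≤ L/2 for every x ∈ Λ. Let (Ω, ℙ) be a probability space with expectation 𝔼 and ω ↦ H_Λ(ω) a measurable family of self-adjoint operators on ℓ²(Λ). Let J₊, J₋ be disjoint intervals contained in an interval J ⊂ ℝ, let f₊, f₋ : ℝ → ℝ be Borel functions with 0 ≤ f_± ≤ χ_{J_±}, set F_± := f_±(H_Λ) and Q := χ_J(H_Λ) (spectral calculus), and let X₁ be multiplication by the first coordinate x₁ on ℓ²(Λ). Assume: (i) 𝔼{⟨δ_x, F₋ X₁ F₊ X₁ F₋ δ_x⟩} = 𝔼{⟨δ₀, F₋ X₁ F₊ X₁ F₋ δ₀⟩} for all x ∈ Λ; and (ii) there is M ≥ 0 with 𝔼{ (tr Q)² − tr Q } ≤ M |J|² |Λ|². Then 𝔼{⟨δ₀, F₋ X₁ F₊ X₁ F₋ δ₀⟩} ≤ (M/4) |J|² L^{d+2}. -/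

import Mathlib

open MeasureTheory
open scoped InnerProductSpace ENNReal

noncomputable section

abbrev Site (d : ℕ) := Fin d → ℤ

open Filter Topology

/-- If all power sums of a random finite family of reals are measurable, then so is the sum of the
values of any continuous function. -/
lemma measurable_sum_continuous_of_powerSums {ι Ω : Type*} [Fintype ι] [MeasurableSpace Ω]
    {μ : Ω → ι → ℝ} (h : ∀ n : ℕ, Measurable fun ω => ∑ i, μ ω i ^ n)
    {g : ℝ → ℝ} (hg : Continuous g) : Measurable fun ω => ∑ i, g (μ ω i) := by
  have hpoly (p : Polynomial ℝ) : Measurable fun ω => ∑ i, p.eval (μ ω i) := by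
    simp_rw [Polynomial.eval_eq_sum_range]
    simp_rw [Finset.sum_comm (s := Finset.univ), ← Finset.mul_sum]
    exact Finset.measurable_fun_sum _ fun n _ => (h n).const_mul _
  choose p hp using fun n : ℕ => exists_polynomial_near_of_continuousOn (-(n : ℝ)) n g
    hg.continuousOn (1 / ((n : ℝ) + 1)) Nat.one_div_pos_of_nat
  have hlim (t : ℝ) : Tendsto (fun n => (p n).eval t) atTop (𝓝 (g t)) := by
    rw [tendsto_iff_dist_tendsto_zero]
    refine squeeze_zero' (Eventually.of_forall fun _ => dist_nonneg) ?_
      tendsto_one_div_add_atTop_nhds_zero_nat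
    filter_upwards [tendsto_natCast_atTop_atTop.eventually_ge_atTop |t|] with n hn
    exact (hp n t (abs_le.mp hn)).le
  refine measurable_of_tendsto_metrizable (fun n => hpoly (p n)) ?_
  exact tendsto_pi_nhds.2 fun ω => tendsto_finsetSum _ fun i _ => hlim _

/-- If all power sums of a random finite family of reals are measurable, then so is the number of
its members lying in a given Borel set. -/
lemma measurable_sum_indicator_of_powerSums {ι Ω : Type*} [Fintype ι] [MeasurableSpace Ω]
    {μ : Ω → ι → ℝ} (h : ∀ n : ℕ, Measurable fun ω => ∑ i, μ ω i ^ n)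
    {s : Set ℝ} (hs : MeasurableSet s) :
    Measurable fun ω => ∑ i, s.indicator (1 : ℝ → ℝ) (μ ω i) := by
  let κ : Ω → Measure ℝ := fun ω => ∑ i, Measure.dirac (μ ω i)
  have hκ (ω : Ω) {t : Set ℝ} (ht : MeasurableSet t) :
      κ ω t = ENNReal.ofReal (∑ i, t.indicator (1 : ℝ → ℝ) (μ ω i)) := by
    have hnonneg : ∀ i ∈ Finset.univ, 0 ≤ t.indicator (1 : ℝ → ℝ) (μ ω i) :=
      fun i _ => Set.indicator_nonneg (fun _ _ => zero_le_one) _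
    rw [ENNReal.ofReal_sum_of_nonneg hnonneg]
    simp only [κ, Measure.finsetSum_apply, Measure.dirac_apply' _ ht]
    refine Finset.sum_congr rfl fun i _ => ?_
    by_cases hi : μ ω i ∈ t <;> simp [hi]
  have hfin (ω : Ω) : IsFiniteMeasure (κ ω) :=
    ⟨by rw [hκ ω MeasurableSet.univ]; exact ENNReal.ofReal_lt_top⟩
  have hmeas : Measurable κ := by
    refine Measurable.measure_of_isPiSystem
      (BorelSpace.measurable_eq.trans borel_eq_generateFrom_isClosed) isPiSystem_isClosed
      (fun t ht => ?_) ?_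
    · have ht : IsClosed t := ht
      simp_rw [hκ _ ht.measurableSet]
      refine ENNReal.measurable_ofReal.comp (measurable_of_tendsto_metrizable
        (f := fun n ω => ∑ i, (ht.apprSeq n (μ ω i) : ℝ))
        (fun n => measurable_sum_continuous_of_powerSums h
          (NNReal.continuous_coe.comp (ht.apprSeq n).continuous)) ?_)
      refine tendsto_pi_nhds.2 fun ω => tendsto_finsetSum _ fun i _ => ?_
      have := (NNReal.continuous_coe.tendsto _).comp
        (tendsto_pi_nhds.1 (HasOuterApproxClosed.tendsto_apprSeq ht) (μ ω i))
      have hcoe : t.indicator (1 : ℝ → ℝ) (μ ω i)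
          = ((t.indicator (fun _ => 1) (μ ω i) : NNReal) : ℝ) := by
        by_cases hi : μ ω i ∈ t <;> simp [hi]
      rwa [hcoe]
    · simp_rw [hκ _ MeasurableSet.univ]
      simp
  have := (Measure.measurable_measure.1 hmeas s hs).ennreal_toReal
  simp_rw [hκ _ hs] at this
  convert this using 2
  exact (ENNReal.toReal_ofReal (Finset.sum_nonneg
    fun i _ => Set.indicator_nonneg (fun _ _ => zero_le_one) _)).symm

section InnerProduct

variable {ι E : Type*} [Fintype ι] [NormedAddCommGroup E] [InnerProductSpace ℂ E]

lemma trace_eq_sum_of_diagonal (b : OrthonormalBasis ι ℂ E) {T : E →ₗ[ℂ] E} {c : ι → ℂ}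
    (hT : ∀ i, T (b i) = c i • b i) : LinearMap.trace ℂ E T = ∑ i, c i := by
  simp [LinearMap.trace_eq_sum_inner T b, hT, inner_smul_right]

lemma measurable_inner_pow_apply {Ω : Type*} [MeasurableSpace Ω] (e : OrthonormalBasis ι ℂ E)
    {H : Ω → E →L[ℂ] E} (hH : ∀ φ ψ : E, Measurable fun ω => ⟪φ, H ω ψ⟫_ℂ) (n : ℕ) (φ ψ : E) :
    Measurable fun ω => ⟪φ, (H ω ^ n) ψ⟫_ℂ := by
  induction n generalizing φ ψ with
  | zero => simp
  | succ n ih =>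
    have key (ω : Ω) : ⟪φ, (H ω ^ (n + 1)) ψ⟫_ℂ
        = ∑ x, ⟪φ, (H ω ^ n) (e x)⟫_ℂ * ⟪e x, H ω ψ⟫_ℂ := by
      conv_lhs => rw [pow_succ, mul_apply_eq_comp, ← e.sum_repr' (H ω ψ)]
      simp only [map_sum, map_smul, inner_sum, inner_smul_right, mul_comm]
    simp_rw [key]
    exact Finset.measurable_fun_sum _ fun x _ => (ih _ _).mul (hH _ _)

lemma measurable_sum_eigenvalues_pow {Ω : Type*} [MeasurableSpace Ω]
    (e : OrthonormalBasis ι ℂ E) {H : Ω → E →L[ℂ] E}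
    (hH : ∀ φ ψ : E, Measurable fun ω => ⟪φ, H ω ψ⟫_ℂ)
    (b : Ω → OrthonormalBasis ι ℂ E) (μ : Ω → ι → ℝ)
    (hb : ∀ ω i, H ω (b ω i) = (μ ω i : ℂ) • b ω i) (n : ℕ) :
    Measurable fun ω => ∑ i, μ ω i ^ n := by
  have hpow (ω : Ω) (i : ι) : (H ω ^ n) (b ω i) = ((μ ω i : ℂ) ^ n) • b ω i := by
    induction n with
    | zero => simp
    | succ n ih =>
      rw [pow_succ, mul_apply_eq_comp, hb, map_smul, ih, smul_smul, pow_succ, mul_comm]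
  have key (ω : Ω) : ∑ i, μ ω i ^ n = (∑ x, ⟪e x, (H ω ^ n) (e x)⟫_ℂ).re := by
    have h1 := LinearMap.trace_eq_sum_inner ((H ω ^ n : E →L[ℂ] E) : E →ₗ[ℂ] E) e
    rw [trace_eq_sum_of_diagonal (b ω) (hpow ω)] at h1
    simp only [ContinuousLinearMap.coe_coe] at h1
    rw [← h1]
    norm_cast
  simp_rw [key]
  exact Complex.measurable_re.comp
    (Finset.measurable_fun_sum _ fun x _ => measurable_inner_pow_apply e hH n _ _)

lemma inner_diagonal_apply (b : OrthonormalBasis ι ℂ E) {T : E →L[ℂ] E} {c : ι → ℝ}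
    (hT : ∀ i, T (b i) = (c i : ℂ) • b i) (i : ι) (v : E) :
    ⟪b i, T v⟫_ℂ = c i * ⟪b i, v⟫_ℂ := by
  classical
  conv_lhs => rw [← b.sum_repr' v]
  simp [hT, b.inner_eq_ite, mul_comm]

lemma re_trace_sandwich_eq (b : OrthonormalBasis ι ℂ E) {A B X : E →L[ℂ] E} {p m : ι → ℝ}
    (hA : ∀ i, A (b i) = (p i : ℂ) • b i) (hB : ∀ i, B (b i) = (m i : ℂ) • b i)
    (hX : ∀ v w : E, ⟪X v, w⟫_ℂ = ⟪v, X w⟫_ℂ) :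
    (LinearMap.trace ℂ E ((B ∘L X ∘L A ∘L X ∘L B : E →L[ℂ] E) : E →ₗ[ℂ] E)).re
      = ∑ i, ∑ j, m i ^ 2 * p j * ‖⟪b j, X (b i)⟫_ℂ‖ ^ 2 := by
  rw [LinearMap.trace_eq_sum_inner _ b, Complex.re_sum]
  refine Finset.sum_congr rfl fun i _ => ?_
  have : ⟪b i, (B ∘L X ∘L A ∘L X ∘L B) (b i)⟫_ℂ
      = ((∑ j, m i ^ 2 * p j * ‖⟪b j, X (b i)⟫_ℂ‖ ^ 2 : ℝ) : ℂ) := by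
    simp only [ContinuousLinearMap.comp_apply]
    rw [inner_diagonal_apply b hB, hB, map_smul, map_smul, map_smul, inner_smul_right, ← hX,
      ← b.sum_inner_mul_inner, Finset.mul_sum, Finset.mul_sum]
    push_cast
    refine Finset.sum_congr rfl fun j _ => ?_
    rw [inner_diagonal_apply b hA, ← Complex.conj_mul', inner_conj_symm]
    ring
  rw [ContinuousLinearMap.coe_coe, this, Complex.ofReal_re]

/-- The trace of `B X A X B` is controlled by the number of pairs of distinct eigenvalues in an
ambient set `J` when the functions defining `A` and `B` are dominated by indicators of disjoint
subsets of `J`. -/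
lemma re_trace_sandwich_le (b : OrthonormalBasis ι ℂ E) {A B X : E →L[ℂ] E} {μ : ι → ℝ}
    {fp fm : ℝ → ℝ} {J Jp Jm : Set ℝ} (hdisj : Disjoint Jp Jm) (hp : Jp ⊆ J) (hm : Jm ⊆ J)
    (hfp0 : ∀ t, 0 ≤ fp t) (hfp1 : ∀ t, fp t ≤ Jp.indicator 1 t)
    (hfm0 : ∀ t, 0 ≤ fm t) (hfm1 : ∀ t, fm t ≤ Jm.indicator 1 t)
    (hA : ∀ i, A (b i) = (fp (μ i) : ℂ) • b i) (hB : ∀ i, B (b i) = (fm (μ i) : ℂ) • b i)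
    (hX : ∀ v w : E, ⟪X v, w⟫_ℂ = ⟪v, X w⟫_ℂ) {R : ℝ} (hR : ∀ v, ‖X v‖ ≤ R * ‖v‖) :
    (LinearMap.trace ℂ E ((B ∘L X ∘L A ∘L X ∘L B : E →L[ℂ] E) : E →ₗ[ℂ] E)).re
      ≤ R ^ 2 * ((∑ i, J.indicator 1 (μ i)) ^ 2 - ∑ i, J.indicator 1 (μ i)) := by
  classical
  have hpairs : (∑ i, J.indicator (1 : ℝ → ℝ) (μ i)) ^ 2 - ∑ i, J.indicator 1 (μ i)
      = ∑ i, ∑ j, (J.indicator 1 (μ i) * J.indicator 1 (μ j)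
          - if i = j then J.indicator 1 (μ i) else 0) := by
    simp [sq, Finset.sum_mul_sum, Finset.sum_sub_distrib]
  rw [re_trace_sandwich_eq b hA hB hX, hpairs, Finset.mul_sum]
  refine Finset.sum_le_sum fun i _ => ?_
  rw [Finset.mul_sum]
  refine Finset.sum_le_sum fun j _ => ?_
  have hmat : ‖⟪b j, X (b i)⟫_ℂ‖ ^ 2 ≤ R ^ 2 := by
    gcongr
    simpa using (norm_inner_le_norm (𝕜 := ℂ) (b j) (X (b i))).trans
      (mul_le_mul_of_nonneg_left (hR (b i)) (norm_nonneg _))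
  have hcoef : fm (μ i) ^ 2 * fp (μ j) ≤ J.indicator 1 (μ i) * J.indicator 1 (μ j)
      - if i = j then J.indicator 1 (μ i) else 0 := by
    have hi0 := hfm0 (μ i)
    have hi1 := hfm1 (μ i)
    have hj0 := hfp0 (μ j)
    have hj1 := hfp1 (μ j)
    by_cases hi : μ i ∈ Jm
    · by_cases hj : μ j ∈ Jp
      · have hij : i ≠ j := by
          rintro rfl
          exact Set.disjoint_left.1 hdisj hj hi
        simp only [hi, hj, Set.indicator_of_mem, Pi.one_apply] at hi1 hj1
        simpa [hij, hm hi, hp hj] using mul_le_one₀ (pow_le_one₀ hi0 hi1) hj0 hj1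
      · have : fp (μ j) = 0 := le_antisymm (by simpa [hj] using hj1) hj0
        by_cases hij : i = j
        · subst hij
          simp [this, hm hi]
        · simp only [this, mul_zero, hij, if_false, sub_zero]
          exact mul_nonneg (Set.indicator_nonneg (fun _ _ => zero_le_one) _)
            (Set.indicator_nonneg (fun _ _ => zero_le_one) _)
    · have : fm (μ i) = 0 := le_antisymm (by simpa [hi] using hi1) hi0
      by_cases hij : i = j
      · subst hij
        by_cases hiJ : μ i ∈ J <;> simp [this, hiJ]
      · simp only [this, hij, if_false, sub_zero, ne_eq, OfNat.ofNat_ne_zero, not_false_eq_true,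
          zero_pow, zero_mul]
        exact mul_nonneg (Set.indicator_nonneg (fun _ _ => zero_le_one) _)
          (Set.indicator_nonneg (fun _ _ => zero_le_one) _)
  rw [mul_comm (R ^ 2)]
  exact mul_le_mul hcoef hmat (sq_nonneg _)
    ((mul_nonneg (sq_nonneg _) (hfp0 _)).trans hcoef)

end InnerProduct

section Multiplication

variable {ι : Type*} [Fintype ι] {X : EuclideanSpace ℂ ι →L[ℂ] EuclideanSpace ℂ ι} {c : ι → ℝ}

lemma inner_mulOperator_comm (hX : ∀ φ x, X φ x = (c x : ℂ) * φ x) (v w : EuclideanSpace ℂ ι) :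
    ⟪X v, w⟫_ℂ = ⟪v, X w⟫_ℂ := by
  simp only [PiLp.inner_apply, hX]
  refine Finset.sum_congr rfl fun x _ => ?_
  simp
  ring

lemma norm_mulOperator_le (hX : ∀ φ x, X φ x = (c x : ℂ) * φ x) {R : ℝ} (hR0 : 0 ≤ R)
    (hR : ∀ x, |c x| ≤ R) (v : EuclideanSpace ℂ ι) : ‖X v‖ ≤ R * ‖v‖ := by
  refine le_of_sq_le_sq ?_ (by positivity)
  rw [mul_pow, EuclideanSpace.norm_sq_eq, EuclideanSpace.norm_sq_eq, Finset.mul_sum]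
  refine Finset.sum_le_sum fun x _ => ?_
  rw [hX, norm_mul, mul_pow, Complex.norm_real, Real.norm_eq_abs]
  gcongr
  exact hR x

end Multiplication

/-- **Lemma 4.5 (finite-volume bound via Minami's estimate)**: on a cube `Λ` with
`|Λ| ≤ L^d` and `|x₁| ≤ L/2` on `Λ`, translation invariance of the expectation
together with a Minami-type bound `𝔼{(tr Q)² - tr Q} ≤ M |J|² |Λ|²` yields
`𝔼⟨δ₀, F₋ X₁ F₊ X₁ F₋ δ₀⟩ ≤ (M/4) |J|² L^{d+2}`. -/
theorem finite_volume_minami_bound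
    {d : ℕ} (hd : 0 < d) (L : ℝ) (hL : 3 ≤ L)
    (Λ : Finset (Site d))
    (hcube : ∃ k : ℕ, ∀ x : Site d, x ∈ Λ ↔ ∀ i, |x i| ≤ (k : ℤ))
    (h0 : (0 : Site d) ∈ Λ)
    (hcard : (Λ.card : ℝ) ≤ L ^ d)
    (hx1 : ∀ x ∈ Λ, |((x ⟨0, hd⟩ : ℤ) : ℝ)| ≤ L / 2)
    {Ω : Type} [MeasurableSpace Ω] (P : Measure Ω) [IsProbabilityMeasure P]
    (HΛ : Ω → (EuclideanSpace ℂ ↥Λ →L[ℂ] EuclideanSpace ℂ ↥Λ))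
    (hsa : ∀ ω, IsSelfAdjoint (HΛ ω))
    (hmeas : ∀ φ ψ : EuclideanSpace ℂ ↥Λ, Measurable fun ω => ⟪φ, HΛ ω ψ⟫_ℂ)
    (J Jp Jm : Set ℝ)
    (hJ : J.OrdConnected) (hJp : Jp.OrdConnected) (hJm : Jm.OrdConnected)
    (hdisj : Disjoint Jp Jm) (hpsub : Jp ⊆ J) (hmsub : Jm ⊆ J)
    (fp fm : ℝ → ℝ) (hfpmeas : Measurable fp) (hfmmeas : Measurable fm)
    (hfp0 : ∀ t, 0 ≤ fp t) (hfp1 : ∀ t, fp t ≤ Jp.indicator 1 t)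
    (hfm0 : ∀ t, 0 ≤ fm t) (hfm1 : ∀ t, fm t ≤ Jm.indicator 1 t)
    (Fp Fm Q : Ω → (EuclideanSpace ℂ ↥Λ →L[ℂ] EuclideanSpace ℂ ↥Λ))
    -- `F_± = f_±(H_Λ)` and `Q = χ_J(H_Λ)` via the spectral decomposition of `H_Λ`:
    (hdiag : ∀ ω, ∃ (b : OrthonormalBasis ↥Λ ℂ (EuclideanSpace ℂ ↥Λ)) (μ : ↥Λ → ℝ),
      ∀ i, HΛ ω (b i) = ((μ i : ℝ) : ℂ) • b i ∧
           Fp ω (b i) = ((fp (μ i) : ℝ) : ℂ) • b i ∧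
           Fm ω (b i) = ((fm (μ i) : ℝ) : ℂ) • b i ∧
           Q ω (b i) = ((J.indicator 1 (μ i) : ℝ) : ℂ) • b i)
    (X1 : EuclideanSpace ℂ ↥Λ →L[ℂ] EuclideanSpace ℂ ↥Λ)
    (hX1 : ∀ (φ : EuclideanSpace ℂ ↥Λ) (x : ↥Λ),
      X1 φ x = (((x : Site d) ⟨0, hd⟩ : ℤ) : ℂ) * φ x)
    -- hypothesis (i): translation invariance of the expectation
    (hTI : ∀ x : ↥Λ,
      (∫ ω, (⟪EuclideanSpace.single x 1,
          (Fm ω ∘L X1 ∘L Fp ω ∘L X1 ∘L Fm ω) (EuclideanSpace.single x 1)⟫_ℂ).re ∂P)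
        = ∫ ω, (⟪EuclideanSpace.single (⟨0, h0⟩ : ↥Λ) 1,
            (Fm ω ∘L X1 ∘L Fp ω ∘L X1 ∘L Fm ω)
              (EuclideanSpace.single (⟨0, h0⟩ : ↥Λ) 1)⟫_ℂ).re ∂P)
    -- hypothesis (ii): Minami-type estimate
    (M : ℝ) (hM : 0 ≤ M)
    (hMinami :
      (∫ ω, ((LinearMap.trace ℂ (EuclideanSpace ℂ ↥Λ)
              ((Q ω : EuclideanSpace ℂ ↥Λ →ₗ[ℂ] EuclideanSpace ℂ ↥Λ))).re ^ 2
            - (LinearMap.trace ℂ (EuclideanSpace ℂ ↥Λ)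
              ((Q ω : EuclideanSpace ℂ ↥Λ →ₗ[ℂ] EuclideanSpace ℂ ↥Λ))).re) ∂P)
        ≤ M * (volume J).toReal ^ 2 * (Λ.card : ℝ) ^ 2) :
    (∫ ω, (⟪EuclideanSpace.single (⟨0, h0⟩ : ↥Λ) 1,
        (Fm ω ∘L X1 ∘L Fp ω ∘L X1 ∘L Fm ω)
          (EuclideanSpace.single (⟨0, h0⟩ : ↥Λ) 1)⟫_ℂ).re ∂P)
      ≤ M / 4 * (volume J).toReal ^ 2 * L ^ (d + 2) := by
  have hRHS : 0 ≤ M / 4 * (volume J).toReal ^ 2 * L ^ (d + 2) := by positivity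
  choose b μ hbμ using hdiag
  set D : ↥Λ → Ω → ℝ := fun x ω => (⟪EuclideanSpace.single x 1,
    (Fm ω ∘L X1 ∘L Fp ω ∘L X1 ∘L Fm ω) (EuclideanSpace.single x 1)⟫_ℂ).re with hD
  change ∀ x, ∫ ω, D x ω ∂P = ∫ ω, D ⟨0, h0⟩ ω ∂P at hTI
  change ∫ ω, D ⟨0, h0⟩ ω ∂P ≤ _
  -- A non-integrable diagonal entry makes all the integrals vanish.
  by_cases hint : ∀ x, Integrable (D x) P
  swap
  · obtain ⟨x, hx⟩ := not_forall.1 hint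
    rwa [← hTI x, integral_undef hx]
  set N : Ω → ℝ := fun ω => ∑ i, J.indicator (1 : ℝ → ℝ) (μ ω i) with hN
  have hNmeas : Measurable N := measurable_sum_indicator_of_powerSums
    (measurable_sum_eigenvalues_pow (EuclideanSpace.basisFun ↥Λ ℂ) hmeas b μ
      fun ω i => (hbμ ω i).1) hJ.measurableSet
  have hN0 (ω : Ω) : 0 ≤ N ω :=
    Finset.sum_nonneg fun i _ => Set.indicator_nonneg (fun _ _ => zero_le_one) _
  have hN1 (ω : Ω) : N ω ≤ Λ.card := by
    simpa [hN] using Finset.sum_le_card_nsmul Finset.univ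
      (fun i => J.indicator (1 : ℝ → ℝ) (μ ω i)) 1
      fun i _ => Set.indicator_apply_le' (fun _ => le_rfl) fun _ => zero_le_one
  have hNint : Integrable (fun ω => N ω ^ 2 - N ω) P := by
    refine Integrable.of_bound ((hNmeas.pow_const 2).sub hNmeas).aestronglyMeasurable
      ((Λ.card : ℝ) ^ 2 + Λ.card) (Eventually.of_forall fun ω => ?_)
    have := pow_le_pow_left₀ (hN0 ω) (hN1 ω) 2
    rw [Real.norm_eq_abs, abs_le]
    constructor <;> nlinarith [hN0 ω, hN1 ω, sq_nonneg (N ω)]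
  have htrQ (ω : Ω) : (LinearMap.trace ℂ (EuclideanSpace ℂ ↥Λ)
      (Q ω : EuclideanSpace ℂ ↥Λ →ₗ[ℂ] EuclideanSpace ℂ ↥Λ)).re = N ω := by
    rw [trace_eq_sum_of_diagonal (b ω) fun i => (hbμ ω i).2.2.2, ← Complex.ofReal_sum,
      Complex.ofReal_re]
  simp_rw [htrQ] at hMinami
  have hX1' : ∀ (φ : EuclideanSpace ℂ ↥Λ) (x : ↥Λ),
      X1 φ x = ((((x : Site d) ⟨0, hd⟩ : ℤ) : ℝ) : ℂ) * φ x := by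
    intro φ x
    rw [hX1]
    norm_cast
  have hbound (ω : Ω) : ∑ x, D x ω ≤ (L / 2) ^ 2 * (N ω ^ 2 - N ω) := by
    refine le_trans (le_of_eq ?_) (re_trace_sandwich_le (b ω) hdisj hpsub hmsub hfp0 hfp1
      hfm0 hfm1 (fun i => (hbμ ω i).2.1) (fun i => (hbμ ω i).2.2.1)
      (inner_mulOperator_comm hX1')
      (norm_mulOperator_le hX1' (by positivity) fun x => hx1 x x.2))
    rw [LinearMap.trace_eq_sum_inner _ (EuclideanSpace.basisFun ↥Λ ℂ), Complex.re_sum]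
    simp [hD]
  have hsum : (Λ.card : ℝ) * ∫ ω, D ⟨0, h0⟩ ω ∂P
      ≤ (L / 2) ^ 2 * (M * (volume J).toReal ^ 2 * (Λ.card : ℝ) ^ 2) := by
    calc (Λ.card : ℝ) * ∫ ω, D ⟨0, h0⟩ ω ∂P = ∑ x, ∫ ω, D x ω ∂P := by simp [hTI]
      _ = ∫ ω, ∑ x, D x ω ∂P := (integral_finsetSum _ fun x _ => hint x).symm
      _ ≤ ∫ ω, (L / 2) ^ 2 * (N ω ^ 2 - N ω) ∂P :=
        integral_mono (integrable_finsetSum _ fun x _ => hint x) (hNint.const_mul _) hbound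
      _ ≤ _ := by
        rw [integral_const_mul]
        gcongr
  have hΛ : (0 : ℝ) < Λ.card := by exact_mod_cast Finset.card_pos.2 ⟨0, h0⟩
  calc ∫ ω, D ⟨0, h0⟩ ω ∂P
      ≤ (L / 2) ^ 2 * (M * (volume J).toReal ^ 2) * Λ.card :=
        le_of_mul_le_mul_left (hsum.trans_eq (by ring)) hΛ
    _ ≤ (L / 2) ^ 2 * (M * (volume J).toReal ^ 2) * L ^ d := by gcongr
    _ = M / 4 * (volume J).toReal ^ 2 * L ^ (d + 2) := by ring

end
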